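/- arXiv:math/0212250 — 3 statements merged into one kernel-verified Lean document; each statement's English description precedes it below -/
import Mathlib

section
/- For every natural number k, the abelian group G_k is ℵ₁-free: every countable subgroup of G_k is a free abelian group. In particular, for every countable set U ⊆ 2^ω the subgroup G_U of G_k is a free abelian group. -/
/-- The generators of the abelian group `G_k`: `x_{m,η̄,ν}` with `m ≤ k`,
`η̄ : ({0,…,k} ∖ {m}) → 2^ω` and `ν ∈ 2^{<ω}`, and `y_{η̄,n}` with
`η̄ : {0,…,k} → 2^ω` and `n ∈ ℕ`. -/
inductive Gen (k : ℕ) where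
  | x (m : Fin (k + 1)) (η : {ℓ : Fin (k + 1) // ℓ ≠ m} → ℕ → Bool) (ν : List Bool)
  | y (η : Fin (k + 1) → ℕ → Bool) (n : ℕ)

/-- The defining relation of `G_k` for `η̄ ∈ (2^ω)^{k+1}` and `n`, as an element of the
free abelian group on the generators:
`n!·y_{η̄,n+1} - y_{η̄,n} - Σ_{m ≤ k} x_{m, η̄↾({0,…,k}∖{m}), η_m↾n}`. -/
def relGk (k : ℕ) (η : Fin (k + 1) → ℕ → Bool) (n : ℕ) : FreeAbelianGroup (Gen k) :=
  (n.factorial : ℤ) • FreeAbelianGroup.of (Gen.y η (n + 1))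
    - FreeAbelianGroup.of (Gen.y η n)
    - ∑ m : Fin (k + 1),
        FreeAbelianGroup.of (Gen.x m (fun ℓ => η ℓ.1) ((List.range n).map (η m)))

/-- The subgroup of relations defining `G_k`. -/
def relSubgroup (k : ℕ) : AddSubgroup (FreeAbelianGroup (Gen k)) :=
  AddSubgroup.closure {z | ∃ η n, z = relGk k η n}

/-- The abelian group `G_k`, presented by the generators `Gen k` and the relations
`n!·y_{η̄,n+1} = y_{η̄,n} + Σ_{m ≤ k} x_{m, η̄↾({0,…,k}∖{m}), η_m↾n}`. -/
abbrev Gk (k : ℕ) : Type := FreeAbelianGroup (Gen k) ⧸ relSubgroup k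

/-- The image in `G_k` of a generator. -/
def genMk (k : ℕ) (g : Gen k) : Gk k :=
  QuotientAddGroup.mk (FreeAbelianGroup.of g)

/-- The generators all of whose `2^ω`-indices lie in `U`. -/
def genIn (k : ℕ) (U : Set (ℕ → Bool)) : Set (Gen k) :=
  {g | match g with
    | .x _ η _ => ∀ ℓ, η ℓ ∈ U
    | .y η _ => ∀ ℓ, η ℓ ∈ U}

/-- The subgroup `G_U` of `G_k` generated by the generators whose indices all lie
in `U`. -/
def GU (k : ℕ) (U : Set (ℕ → Bool)) : AddSubgroup (Gk k) :=
  AddSubgroup.closure (genMk k '' genIn k U)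

/-- The subgroup `G_{U,u}` of `G_k` generated by the union of the subgroups
`G_{U ∪ (u ∖ {η})}` for `η ∈ u`. -/
def GUu (k : ℕ) (U u : Set (ℕ → Bool)) : AddSubgroup (Gk k) :=
  ⨆ η ∈ u, GU k (U ∪ (u \ {η}))

/-- A submodule of a free module `ι →₀ R` over a principal ideal domain is free. -/
theorem Submodule.free_of_finsupp {R ι : Type*} [CommRing R] [IsDomain R]
    [IsPrincipalIdealRing R] (N : Submodule R (ι →₀ R)) : Module.Free R N := by
  classical
  obtain ⟨_, _⟩ := exists_wellFoundedLT ι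
  let P : ι → Submodule R (ι →₀ R) := fun i => N ⊓ Finsupp.supported R R (Set.Iic i)
  let I : ι → Ideal R := fun i => (P i).map (Finsupp.lapply i)
  have hI : ∀ i, ∃ f ∈ P i, I i = Ideal.span {f i} := by
    intro i
    obtain ⟨a, ha⟩ := IsPrincipalIdealRing.principal (I i)
    have : a ∈ I i := by rw [ha]; exact Submodule.mem_span_singleton_self a
    obtain ⟨f, hf, rfl⟩ := this
    exact ⟨f, hf, ha⟩
  choose f hf hspan using hI
  have hfN : ∀ i, f i ∈ N := fun i => (hf i).1
  have hf0 : ∀ i j, i < j → f i j = 0 := by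
    intro i j hij
    by_contra h
    have := (Finsupp.mem_supported R _).1 (hf i).2 (Finsupp.mem_support_iff.2 h)
    exact absurd hij (not_lt.2 this)
  let v : {i // f i i ≠ 0} → ι →₀ R := fun i => f i.1
  have hli : LinearIndependent R v := by
    rw [linearIndependent_iff]
    intro l hl
    by_contra hne
    have hs : l.support.Nonempty := Finsupp.support_nonempty_iff.2 hne
    set j := l.support.max' hs with hj
    have hjm : j ∈ l.support := Finset.max'_mem _ _
    have h := DFunLike.congr_fun hl j.1
    rw [Finsupp.linearCombination_apply, Finsupp.sum, Finsupp.finsetSum_apply,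
      Finset.sum_eq_single_of_mem j hjm] at h
    · simp only [Finsupp.smul_apply, smul_eq_mul, Finsupp.coe_zero, Pi.zero_apply, v] at h
      exact (mul_ne_zero (Finsupp.mem_support_iff.1 hjm) j.2) h
    · intro b hb hbj
      have hlt : b.1 < j.1 := lt_of_le_of_ne (Finset.le_max' _ _ hb) (fun h => hbj (Subtype.ext h))
      simp [v, hf0 _ _ hlt]
  have key : ∀ i, ∀ g ∈ P i, g ∈ Submodule.span R (Set.range v) := by
    intro i
    induction i using WellFoundedLT.induction with
    | ind i ih =>
      intro g hg
      have hgi : g i ∈ Ideal.span {f i i} := hspan i ▸ Submodule.mem_map_of_mem hg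
      obtain ⟨c, hc⟩ := Ideal.mem_span_singleton'.1 hgi
      obtain ⟨d, hd, hdi⟩ : ∃ d ∈ P i ⊓ Submodule.span R (Set.range v), d i = g i := by
        by_cases h0 : f i i = 0
        · exact ⟨0, Submodule.zero_mem _, by simp [← hc, h0]⟩
        · exact ⟨c • f i, ⟨Submodule.smul_mem _ _ (hf i),
            Submodule.smul_mem _ _ (Submodule.subset_span ⟨⟨i, h0⟩, rfl⟩)⟩, by simp [hc]⟩
      suffices h : g - d ∈ Submodule.span R (Set.range v) by
        simpa using Submodule.add_mem _ h hd.2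
      have hP : g - d ∈ P i := Submodule.sub_mem _ hg hd.1
      by_cases hz : g - d = 0
      · rw [hz]; exact Submodule.zero_mem _
      have hs : (g - d).support.Nonempty := Finsupp.support_nonempty_iff.2 hz
      have hm := Finset.max'_mem _ hs
      refine ih ((g - d).support.max' hs) (lt_of_le_of_ne ?_ ?_) (g - d) ⟨hP.1, ?_⟩
      · exact (Finsupp.mem_supported R _).1 hP.2 hm
      · intro h
        rw [h, Finsupp.mem_support_iff] at hm
        exact hm (by simp [hdi])
      · exact (Finsupp.mem_supported R _).2 fun j hj => Finset.le_max' _ _ hj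
  have hN : N = Submodule.span R (Set.range v) := by
    apply le_antisymm
    · intro g hg
      by_cases hz : g = 0
      · rw [hz]; exact Submodule.zero_mem _
      have hs : g.support.Nonempty := Finsupp.support_nonempty_iff.2 hz
      exact key (g.support.max' hs) g
        ⟨hg, (Finsupp.mem_supported R _).2 fun j hj => Finset.le_max' _ _ hj⟩
    · rw [Submodule.span_le]
      rintro _ ⟨i, rfl⟩
      exact hfN i.1
  rw [hN]
  exact Module.Free.of_basis (Module.Basis.span hli)

/-- A module that embeds into a free module over a principal ideal domain is free. -/
theorem Module.Free.of_injective_of_isPrincipalIdealRing {R M N : Type*} [CommRing R] [IsDomain R]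
    [IsPrincipalIdealRing R] [AddCommGroup M] [Module R M] [AddCommGroup N] [Module R N]
    [Module.Free R M] (f : N →ₗ[R] M) (hf : Function.Injective f) : Module.Free R N := by
  let g := (Module.Free.chooseBasis R M).repr.toLinearMap ∘ₗ f
  have hg : Function.Injective g :=
    (Module.Free.chooseBasis R M).repr.injective.comp hf
  have := Submodule.free_of_finsupp (LinearMap.range g)
  exact Module.Free.of_equiv (LinearEquiv.ofInjective g hg).symm

/-- Initial segments of the branches in a countable set become pairwise different beyond
suitable levels. -/
theorem exists_separating_level {U : Set (ℕ → Bool)} (hU : U.Countable) :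
    ∃ N : (ℕ → Bool) → ℕ, ∀ a ∈ U, ∀ b ∈ U, ∀ n, N a ≤ n → N b ≤ n →
      (∀ i < n, a i = b i) → a = b := by
  obtain ⟨e, he⟩ := Set.countable_iff_exists_injOn.1 hU
  have hfin : ∀ a, ({b ∈ U | e b < e a}).Finite := fun a =>
    Set.Finite.of_finite_image ((Set.finite_Iio (e a)).subset (by rintro _ ⟨b, hb, rfl⟩; exact hb.2))
      (he.mono fun b hb => hb.1)
  have hN : ∀ a, ∃ N, ∀ b ∈ U, e b < e a → ∃ i < N, a i ≠ b i := by
    intro a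
    have hd : ∀ b, e b < e a → ∃ i, a i ≠ b i := by
      intro b hb
      by_contra! h
      rw [funext h] at hb
      exact lt_irrefl _ hb
    choose! d hd using hd
    refine ⟨(hfin a).toFinset.sup d + 1, fun b hb hlt => ⟨d b, ?_, hd b hlt⟩⟩
    exact Nat.lt_succ_of_le (Finset.le_sup (f := d) ((hfin a).mem_toFinset.2 ⟨hb, hlt⟩))
  choose N hN using hN
  refine ⟨N, fun a ha b hb n hna hnb hab => ?_⟩
  rcases lt_trichotomy (e a) (e b) with h | h | h
  · obtain ⟨i, hi, hne⟩ := hN b a ha h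
    exact absurd (hab i (by omega)).symm hne
  · exact he ha hb h
  · obtain ⟨i, hi, hne⟩ := hN a b hb h
    exact absurd (hab i (by omega)) hne

section Gk

variable {k : ℕ}

theorem FreeAbelianGroup.coeff_of {X : Type*} [DecidableEq X] (g h : X) :
    FreeAbelianGroup.coeff g (FreeAbelianGroup.of h) = if h = g then 1 else 0 := by
  simp [FreeAbelianGroup.coeff, Finsupp.single_apply]

/-- The combination of relations with coefficients `c`. -/
noncomputable def relComb (k : ℕ) :
    ((Fin (k + 1) → ℕ → Bool) × ℕ →₀ ℤ) →ₗ[ℤ] FreeAbelianGroup (Gen k) :=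
  Finsupp.linearCombination ℤ fun p => relGk k p.1 p.2

theorem mem_relSubgroup_iff (z : FreeAbelianGroup (Gen k)) :
    z ∈ relSubgroup k ↔ ∃ c, relComb k c = z := by
  have h : {z | ∃ η n, z = relGk k η n} =
      Set.range fun p : (Fin (k + 1) → ℕ → Bool) × ℕ => relGk k p.1 p.2 := by
    ext z; simp [eq_comm]
  rw [relSubgroup, h, ← Submodule.span_int_eq_addSubgroupClosure, Submodule.mem_toAddSubgroup,
    ← Finsupp.range_linearCombination]
  rfl

theorem coeff_y_zero_relComb (η : Fin (k + 1) → ℕ → Bool)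
    (c : (Fin (k + 1) → ℕ → Bool) × ℕ →₀ ℤ) :
    FreeAbelianGroup.coeff (Gen.y η 0) (relComb k c) = -c (η, 0) := by
  classical
  induction c using Finsupp.induction_linear with
  | zero => simp
  | add c d hc hd => rw [map_add, map_add, hc, hd, Finsupp.add_apply]; ring
  | single p z =>
    obtain ⟨ξ, j⟩ := p
    simp [relComb, relGk, FreeAbelianGroup.coeff_of, Finsupp.single_apply]

theorem coeff_y_succ_relComb (η : Fin (k + 1) → ℕ → Bool) (n : ℕ)
    (c : (Fin (k + 1) → ℕ → Bool) × ℕ →₀ ℤ) :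
    FreeAbelianGroup.coeff (Gen.y η (n + 1)) (relComb k c) =
      n.factorial * c (η, n) - c (η, n + 1) := by
  classical
  induction c using Finsupp.induction_linear with
  | zero => simp
  | add c d hc hd => rw [map_add, map_add, hc, hd, Finsupp.add_apply, Finsupp.add_apply]; ring
  | single p z =>
    obtain ⟨ξ, j⟩ := p
    simp only [relComb, relGk, Finsupp.linearCombination_single, map_zsmul, map_sub, map_sum,
      FreeAbelianGroup.coeff_of, Finsupp.single_apply, Gen.y.injEq, reduceCtorEq,
      Prod.mk.injEq, if_false,
      Finset.sum_const_zero, smul_eq_mul, Nat.add_right_cancel_iff]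
    by_cases hξ : ξ = η
    · by_cases hj : j = n
      · subst hj; simp [hξ, mul_comm]
      · simp [hξ, hj]
    · simp [hξ]

/-- The coefficient of an `x`-generator in the direction `0`. -/
theorem coeff_x_relComb [DecidableEq (Gen k)] (η : {ℓ : Fin (k + 1) // ℓ ≠ 0} → ℕ → Bool)
    (ν : List Bool) (c : (Fin (k + 1) → ℕ → Bool) × ℕ →₀ ℤ) :
    FreeAbelianGroup.coeff (Gen.x 0 η ν) (relComb k c) =
      -c.sum fun p z =>
        if Gen.x 0 (fun ℓ => p.1 ℓ.1) ((List.range p.2).map (p.1 0)) = Gen.x 0 η ν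
        then z else 0 := by
  rw [relComb, Finsupp.linearCombination_apply, Finsupp.sum, map_sum, Finsupp.sum,
    ← Finset.sum_neg_distrib]
  refine Finset.sum_congr rfl fun p _ => ?_
  rw [map_zsmul, relGk, map_sub, map_sub, map_zsmul, FreeAbelianGroup.coeff_of,
    FreeAbelianGroup.coeff_of, map_sum,
    Finset.sum_eq_single_of_mem 0 (Finset.mem_univ _), FreeAbelianGroup.coeff_of]
  · simp
  · intro m _ hm
    rw [FreeAbelianGroup.coeff_of, if_neg]
    intro h
    exact hm (Gen.x.inj h).1

/-- A set of generators that freely generates `G_U` when the levels `N` separate the branches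
in `U`. -/
def basisGen (k : ℕ) (U : Set (ℕ → Bool)) (N : (ℕ → Bool) → ℕ) : Set (Gen k) :=
  {g ∈ genIn k U | (∀ η n, g = Gen.y η n → N (η 0) ≤ n) ∧
    ∀ (η : Fin (k + 1) → ℕ → Bool) (n : ℕ), (∀ ℓ, η ℓ ∈ U) → N (η 0) ≤ n →
      g ≠ Gen.x 0 (fun ℓ => η ℓ.1) ((List.range n).map (η 0))}

theorem relComb_coeff_eq_zero {U : Set (ℕ → Bool)} {N : (ℕ → Bool) → ℕ}
    (hN : ∀ a ∈ U, ∀ b ∈ U, ∀ n, N a ≤ n → N b ≤ n → (∀ i < n, a i = b i) → a = b)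
    (c : (Fin (k + 1) → ℕ → Bool) × ℕ →₀ ℤ)
    (hc : ∀ g ∉ basisGen k U N, FreeAbelianGroup.coeff g (relComb k c) = 0) : c = 0 := by
  classical
  have low : ∀ η n, ¬((∀ ℓ, η ℓ ∈ U) ∧ N (η 0) ≤ n) → c (η, n) = 0 := by
    intro η n
    induction n with
    | zero =>
      intro h
      have := hc (Gen.y η 0) fun hg => h ⟨hg.1, hg.2.1 _ _ rfl⟩
      rwa [coeff_y_zero_relComb, neg_eq_zero] at this
    | succ n ih =>
      intro h
      have h1 := hc (Gen.y η (n + 1)) fun hg => h ⟨hg.1, hg.2.1 _ _ rfl⟩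
      rw [coeff_y_succ_relComb, ih fun h' => h ⟨h'.1, h'.2.trans n.le_succ⟩] at h1
      simpa using h1
  ext ⟨η, n⟩
  by_cases h : (∀ ℓ, η ℓ ∈ U) ∧ N (η 0) ≤ n
  swap
  · exact low η n h
  have h1 := hc (Gen.x 0 (fun ℓ => η ℓ.1) ((List.range n).map (η 0)))
    fun hg => hg.2.2 η n h.1 h.2 rfl
  rw [coeff_x_relComb, neg_eq_zero, Finsupp.sum, Finset.sum_eq_single (η, n)] at h1
  · simpa using h1
  · rintro ⟨ξ, j⟩ hp hne
    rw [if_neg]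
    intro heq
    obtain ⟨hξU, hξN⟩ : (∀ ℓ, ξ ℓ ∈ U) ∧ N (ξ 0) ≤ j := by
      by_contra h'
      exact Finsupp.mem_support_iff.1 hp (low ξ j h')
    simp only [Gen.x.injEq, heq_eq_eq, true_and] at heq
    obtain ⟨hrest, hseg⟩ := heq
    have hj : j = n := by simpa using congrArg List.length hseg
    subst hj
    have h0 : ξ 0 = η 0 := hN _ (hξU 0) _ (h.1 0) j hξN h.2 fun i hi =>
      List.map_inj_left.1 hseg i (List.mem_range.2 hi)
    apply hne
    rw [Prod.mk.injEq]
    refine ⟨funext fun ℓ => ?_, rfl⟩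
    by_cases hℓ : ℓ = 0
    · rw [hℓ, h0]
    · exact congrFun hrest ⟨ℓ, hℓ⟩
  · intro hn
    simpa using hn

theorem linearIndependent_basisGen {U : Set (ℕ → Bool)} {N : (ℕ → Bool) → ℕ}
    (hN : ∀ a ∈ U, ∀ b ∈ U, ∀ n, N a ≤ n → N b ≤ n → (∀ i < n, a i = b i) → a = b) :
    LinearIndependent ℤ fun g : basisGen k U N => genMk k g.1 := by
  classical
  rw [linearIndependent_iff]
  intro l hl
  let z : FreeAbelianGroup (Gen k) := l.sum fun g a => a • FreeAbelianGroup.of g.1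
  have hcoeff : ∀ g, FreeAbelianGroup.coeff g z =
      l.sum fun g' a => if g'.1 = g then a else 0 := by
    intro g
    simp only [z, Finsupp.sum, map_sum, map_zsmul, FreeAbelianGroup.coeff_of,
      smul_eq_mul, mul_ite, mul_one,
      mul_zero]
  have hz : z ∈ relSubgroup k := by
    rw [← QuotientAddGroup.eq_zero_iff, ← hl, Finsupp.linearCombination_apply]
    change QuotientAddGroup.mk' (relSubgroup k) z = _
    simp only [z, Finsupp.sum, map_sum, map_zsmul]
    rfl
  obtain ⟨c, hc⟩ := (mem_relSubgroup_iff z).1 hz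
  have hc0 : c = 0 := by
    refine relComb_coeff_eq_zero hN c fun g hg => ?_
    rw [hc, hcoeff]
    refine Finset.sum_eq_zero fun g' _ => if_neg ?_
    rintro rfl
    exact hg g'.2
  have hz0 : z = 0 := by rw [← hc, hc0, map_zero]
  ext g
  have h := hcoeff g.1
  rw [hz0, map_zero] at h
  simp only [← Subtype.ext_iff] at h
  simpa using h.symm

theorem genMk_y (η : Fin (k + 1) → ℕ → Bool) (n : ℕ) :
    (n.factorial : ℤ) • genMk k (Gen.y η (n + 1)) = genMk k (Gen.y η n) +
      ∑ m, genMk k (Gen.x m (fun ℓ => η ℓ.1) ((List.range n).map (η m))) := by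
  have h : QuotientAddGroup.mk' (relSubgroup k) (relGk k η n) = 0 :=
    (QuotientAddGroup.eq_zero_iff _).2 (AddSubgroup.subset_closure ⟨η, n, rfl⟩)
  rw [relGk, map_sub, map_sub, map_zsmul, map_sum, sub_sub, sub_eq_zero] at h
  exact h

theorem GU_le_closure_basisGen (U : Set (ℕ → Bool)) (N : (ℕ → Bool) → ℕ) :
    GU k U ≤ AddSubgroup.closure (genMk k '' basisGen k U N) := by
  set B := AddSubgroup.closure (genMk k '' basisGen k U N)
  have hmem : ∀ g ∈ basisGen k U N, genMk k g ∈ B := fun g hg =>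
    AddSubgroup.subset_closure ⟨g, hg, rfl⟩
  have hyhigh : ∀ η n, (∀ ℓ, η ℓ ∈ U) → N (η 0) ≤ n → genMk k (Gen.y η n) ∈ B := by
    intro η n hη hn
    refine hmem _ ⟨hη, ?_, fun _ _ _ _ => by simp⟩
    rintro _ _ ⟨⟩
    exact hn
  have hx' : ∀ m, m ≠ 0 → ∀ η ν, (∀ ℓ, η ℓ ∈ U) → genMk k (Gen.x m η ν) ∈ B := by
    intro m hm η ν hη
    exact hmem _ ⟨hη, fun _ _ => by simp, fun _ _ _ _ h => hm (Gen.x.inj h).1⟩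
  have hx : ∀ m η ν, (∀ ℓ, η ℓ ∈ U) → genMk k (Gen.x m η ν) ∈ B := by
    intro m η ν hη
    by_cases hg : Gen.x m η ν ∈ basisGen k U N
    · exact hmem _ hg
    have : ∃ (ξ : Fin (k + 1) → ℕ → Bool) (n : ℕ), (∀ ℓ, ξ ℓ ∈ U) ∧ N (ξ 0) ≤ n ∧
        Gen.x m η ν = Gen.x 0 (fun ℓ => ξ ℓ.1) ((List.range n).map (ξ 0)) := by
      by_contra! h
      exact hg ⟨hη, fun _ _ => by simp, h⟩
    obtain ⟨ξ, n, hξ, hn, heq⟩ := this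
    rw [heq]
    have hrel := genMk_y ξ n
    rw [← Finset.add_sum_erase _ _ (Finset.mem_univ (0 : Fin (k + 1))), ← add_assoc,
      add_right_comm, ← sub_eq_iff_eq_add'] at hrel
    rw [← hrel]
    refine B.sub_mem (B.zsmul_mem (hyhigh _ _ hξ (hn.trans n.le_succ)) _)
      (B.add_mem (hyhigh _ _ hξ hn) (B.sum_mem fun m hm => ?_))
    exact hx' m (Finset.ne_of_mem_erase hm) _ _ fun ℓ => hξ _
  have hy : ∀ η n, (∀ ℓ, η ℓ ∈ U) → genMk k (Gen.y η n) ∈ B := by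
    intro η n hη
    rcases le_total (N (η 0)) n with hn | hn
    · exact hyhigh η n hη hn
    induction hn using Nat.decreasingInduction with
    | self => exact hyhigh η _ hη le_rfl
    | of_succ n _ ih =>
      rw [← sub_eq_of_eq_add (genMk_y η n)]
      exact B.sub_mem (B.zsmul_mem ih _) (B.sum_mem fun m _ => hx _ _ _ fun ℓ => hη _)
  rw [GU, AddSubgroup.closure_le]
  rintro _ ⟨g, hg, rfl⟩
  cases g with
  | x m η ν => exact hx m η ν hg
  | y η n => exact hy η n hg

theorem free_GU {U : Set (ℕ → Bool)} (hU : U.Countable) : Module.Free ℤ (GU k U) := by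
  obtain ⟨N, hN⟩ := exists_separating_level hU
  have heq : GU k U =
      (Submodule.span ℤ (Set.range fun g : basisGen k U N => genMk k g.1)).toAddSubgroup := by
    rw [Submodule.span_int_eq_addSubgroupClosure, ← Set.image_eq_range]
    exact le_antisymm (GU_le_closure_basisGen U N)
      (AddSubgroup.closure_mono (Set.image_mono fun g hg => hg.1))
  rw [heq]
  exact Module.Free.of_basis (Module.Basis.span (linearIndependent_basisGen hN))

theorem GU_mono {U V : Set (ℕ → Bool)} (h : U ⊆ V) : GU k U ≤ GU k V := by
  refine AddSubgroup.closure_mono (Set.image_mono fun g hg => ?_)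
  cases g with
  | x m η ν => exact fun ℓ => h (hg ℓ)
  | y η n => exact fun ℓ => h (hg ℓ)

theorem exists_countable_mem_GU (z : Gk k) : ∃ U : Set (ℕ → Bool), U.Countable ∧ z ∈ GU k U := by
  obtain ⟨a, rfl⟩ := QuotientAddGroup.mk_surjective z
  have hgen : ∀ g : Gen k, ∃ U : Set (ℕ → Bool), U.Countable ∧ genMk k g ∈ GU k U := by
    rintro (⟨m, η, ν⟩ | ⟨η, n⟩)
    · exact ⟨Set.range η, Set.countable_range η,
        AddSubgroup.subset_closure ⟨Gen.x m η ν, fun ℓ => Set.mem_range_self ℓ, rfl⟩⟩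
    · exact ⟨Set.range η, Set.countable_range η,
        AddSubgroup.subset_closure ⟨Gen.y η n, fun ℓ => Set.mem_range_self ℓ, rfl⟩⟩
  induction a using FreeAbelianGroup.induction_on with
  | zero => exact ⟨∅, Set.countable_empty, AddSubgroup.zero_mem _⟩
  | of g => exact hgen g
  | neg g _ =>
    obtain ⟨U, hU, h⟩ := hgen g
    exact ⟨U, hU, AddSubgroup.neg_mem _ h⟩
  | add a b ha hb =>
    obtain ⟨U, hU, ha⟩ := ha
    obtain ⟨V, hV, hb⟩ := hb
    exact ⟨U ∪ V, hU.union hV, AddSubgroup.add_mem _ (GU_mono Set.subset_union_left ha)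
      (GU_mono Set.subset_union_right hb)⟩

end Gk

/-- `G_k` is `ℵ₁`-free: every countable subgroup of `G_k` is a free abelian group;
in particular, for every countable `U ⊆ 2^ω` the subgroup `G_U` is a free abelian
group. -/
theorem Gk_aleph1_free (k : ℕ) :
    (∀ H : AddSubgroup (Gk k), Countable H → Module.Free ℤ H) ∧
    (∀ U : Set (ℕ → Bool), U.Countable → Module.Free ℤ (GU k U)) := by
  refine ⟨fun H hH => ?_, fun U hU => free_GU hU⟩
  choose U hU hmem using exists_countable_mem_GU (k := k)
  have hle : H ≤ GU k (⋃ h : H, U h.1) := fun z hz =>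
    GU_mono (Set.subset_iUnion (fun h : H => U h.1) ⟨z, hz⟩) (hmem z)
  have := free_GU (k := k) (Set.countable_iUnion fun h : H => hU h.1)
  exact Module.Free.of_injective_of_isPrincipalIdealRing
    (AddSubgroup.inclusion hle).toIntLinearMap (AddSubgroup.inclusion_injective hle)
end

section
/- Let U ⊆ 2^ω and let u ⊆ 2^ω ∖ U be a nonempty finite set with |u| ≤ k, and suppose the cardinality of U is at most ℵ_{k−|u|}. Then the quotient group G_{U∪u}/G_{U,u} is a free abelian group. -/
open Cardinal in
/-- A set of cardinality at most `ℵ_{j+1}` has a well-order whose closed initial segments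
have cardinality at most `ℵ_j`. -/
theorem exists_wellOrder_mk_Iic_le_aleph {V : Type*} (j : ℕ) (hV : #V ≤ ℵ_ (j + 1 : ℕ)) :
    ∃ (_ : LinearOrder V) (_ : WellFoundedLT V), ∀ a : V, #(Set.Iic a) ≤ ℵ_ j := by
  obtain ⟨hl, hw, h⟩ := exists_ord_eq_type_lt V
  refine ⟨hl, hw, fun a => ?_⟩
  have hlt : #(Set.Iio a) ≤ ℵ_ j := by
    rw [← Order.lt_succ_iff, succ_aleph]
    exact (mk_Iio_lt a h).trans_le (by exact_mod_cast hV)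
  rw [← Set.Iio_insert]
  exact (mk_insert_le).trans
    (add_le_of_le (aleph0_le_aleph _) hlt (one_le_aleph0.trans (aleph0_le_aleph _)))

open Cardinal in
/-- If `|V| ≤ ℵ_j`, then `V^ι` (with `ι` finite) has a well-order such that among any `j + 1`
coordinates of any tuple there is one along which the tuple has only finitely many
predecessors. -/
theorem exists_wellOrder_finite_predecessors {ι : Type*} [Finite ι] [Nonempty ι] (j : ℕ) :
    ∀ (V : Type) (_ : #V ≤ ℵ_ j), ∃ r : (ι → V) → (ι → V) → Prop, IsWellOrder _ r ∧
      ∀ (η : ι → V) (A : Finset ι), j + 1 ≤ A.card →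
        ∃ m ∈ A, {η' | r η' η ∧ ∀ i, i ≠ m → η' i = η i}.Finite := by
  classical
  induction j with
  | zero =>
    intro V hV
    have : Countable V := by
      rw [← mk_le_aleph0_iff]
      simpa using hV
    obtain ⟨f, hf⟩ := exists_injective_nat (ι → V)
    refine ⟨Function.onFun (· < ·) f, hf.isWellOrder (· < ·), fun η A hA => ?_⟩
    obtain ⟨m, hm⟩ := Finset.card_pos.1 (Nat.lt_of_lt_of_le Nat.zero_lt_one hA)
    exact ⟨m, hm, ((Set.finite_Iio (f η)).preimage hf.injOn).subset fun η' h => h.1⟩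
  | succ j ih =>
    intro V hV
    obtain ⟨_, _, hIic⟩ := exists_wellOrder_mk_Iic_le_aleph j hV
    choose r hr hfin using fun a : V => ih (Set.Iic a) (hIic a)
    choose top htop using fun η : ι → V => Finite.exists_max η
    let key (a : V) (η : ι → V) : Ordinal :=
      if h : ∀ i, η i ≤ a then Ordinal.typein (r a) fun i => ⟨η i, h i⟩ else 0
    have key_eq (a : V) (η : ι → V) (h : ∀ i, η i ≤ a) :
        key a η = Ordinal.typein (r a) fun i => ⟨η i, h i⟩ := dif_pos h
    let g (η : ι → V) : V × Ordinal := (η (top η), key (η (top η)) η)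
    have hg : g.Injective := by
      intro η η' h
      obtain ⟨h1, h2⟩ := Prod.ext_iff.1 h
      have h1 : η (top η) = η' (top η') := h1
      have h2 : key (η (top η)) η = key (η' (top η')) η' := h2
      rw [← h1, key_eq _ _ (htop η), key_eq _ _ fun i => h1 ▸ htop η' i] at h2
      have := Ordinal.typein_injective _ h2
      funext i
      exact congrArg Subtype.val (congrFun this i)
    refine ⟨Function.onFun (Prod.Lex (· < ·) (· < ·)) g, hg.isWellOrder (Prod.Lex (· < ·) (· < ·)),
      fun η A hA => ?_⟩
    obtain ⟨m, hm, hmfin⟩ := hfin (η (top η)) (fun i => ⟨η i, htop η i⟩) (A.erase (top η))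
      (by have := Finset.pred_card_le_card_erase (s := A) (a := top η); omega)
    obtain ⟨hmne, hmA⟩ := Finset.mem_erase.1 hm
    refine ⟨m, hmA, (hmfin.image fun η' i => (η' i : V)).subset ?_⟩
    rintro η' ⟨hlt, hoff⟩
    have hle : η (top η) ≤ η' (top η') := hoff (top η) hmne.symm ▸ htop η' (top η)
    have hlt : Prod.Lex (· < ·) (· < ·) (g η') (g η) := hlt
    rw [Prod.lex_def] at hlt
    obtain h | ⟨h1, h2⟩ := hlt
    · exact absurd h hle.not_gt
    · have h1 : η' (top η') = η (top η) := h1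
      have h2 : key (η' (top η')) η' < key (η (top η)) η := h2
      have hb : ∀ i, η' i ≤ η (top η) := fun i => h1 ▸ htop η' i
      rw [h1, key_eq _ _ (htop η), key_eq _ _ hb, Ordinal.typein_lt_typein] at h2
      exact ⟨fun i => ⟨η' i, hb i⟩, ⟨h2, fun i hi => Subtype.ext (hoff i hi)⟩, rfl⟩

/-- Values on the non-pivots extend to a solution of a well-founded triangular system
`φ (p q) = z q - ∑ i, φ (o q i)`. -/
theorem exists_solution_of_triangular {P X M ι : Type*} [AddCommGroup M] {r : P → P → Prop}
    (wf : WellFounded r) {p : P → X} (hp : p.Injective) (I : P → Finset ι) (o : P → ι → X)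
    (ho : ∀ q q', ∀ i ∈ I q, p q' = o q i → r q' q) (f : X → M) (z : P → M) :
    ∃ φ : X → M, (∀ x, x ∉ Set.range p → φ x = f x) ∧
      ∀ q, φ (p q) = z q - ∑ i ∈ I q, φ (o q i) := by
  classical
  let ψ : P → M := wf.fix fun q ih => z q - ∑ i ∈ I q,
    if h : ∃ q', p q' = o q i ∧ r q' q then ih h.choose h.choose_spec.2 else f (o q i)
  refine ⟨Function.extend p ψ f, fun x hx => Function.extend_apply' _ _ _ hx, fun q => ?_⟩
  rw [hp.extend_apply]
  simp only [ψ]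
  rw [wf.fix_eq]
  congr 1
  refine Finset.sum_congr rfl fun i hi => ?_
  by_cases h : ∃ q', p q' = o q i
  · obtain ⟨q', hq'⟩ := h
    have h' : ∃ q', p q' = o q i ∧ r q' q := ⟨q', hq', ho q q' i hi hq'⟩
    have hc : h'.choose = q' := hp (h'.choose_spec.1.trans hq'.symm)
    rw [dif_pos h']
    exact (congrArg ψ hc).trans (by rw [← hq', hp.extend_apply])
  · rw [Function.extend_apply' _ _ _ h, dif_neg fun ⟨a, ha⟩ => h ⟨a, ha.1⟩]

/-- A solution of the recurrence `n! Y_{n+1} = Y_n + c_n` for `n ≥ N` can be continued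
to all `n`. -/
theorem exists_seq_extending {M : Type*} [AddCommGroup M] (c : ℕ → M) (N : ℕ) :
    ∀ Z : ℕ → M, (∀ n ≥ N, (n.factorial : ℤ) • Z (n + 1) = Z n + c n) →
      ∃ Y : ℕ → M, (∀ n, (n.factorial : ℤ) • Y (n + 1) = Y n + c n) ∧ ∀ n ≥ N, Y n = Z n := by
  induction N with
  | zero => exact fun Z hZ => ⟨Z, fun n => hZ n n.zero_le, fun _ _ => rfl⟩
  | succ N ih =>
    intro Z hZ
    obtain ⟨Y, hY, hYZ⟩ := ih
      (Function.update Z N ((N.factorial : ℤ) • Z (N + 1) - c N)) fun n hn => by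
        obtain rfl | hn := eq_or_lt_of_le hn
        · simp
        · rw [Function.update_of_ne (by omega), Function.update_of_ne (by omega), hZ n hn]
    refine ⟨Y, hY, fun n hn => ?_⟩
    rw [hYZ n (by omega), Function.update_of_ne (by omega)]

/-- In a rational vector space the recurrence `n! Y_{n+1} = Y_n + c_n` is solvable, by zero
if `c` is zero. -/
theorem exists_seq_of_rat {M : Type*} [AddCommGroup M] [Module ℚ M] (c : ℕ → M) :
    ∃ Y : ℕ → M, (∀ n, (n.factorial : ℤ) • Y (n + 1) = Y n + c n) ∧ (c = 0 → Y = 0) := by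
  by_cases hc : c = 0
  · exact ⟨0, by simp [hc], fun _ => rfl⟩
  · refine ⟨Nat.rec 0 fun n y => (n.factorial : ℚ)⁻¹ • (y + c n), fun n => ?_,
      fun h => absurd h hc⟩
    have : (n.factorial : ℚ) ≠ 0 := by exact_mod_cast n.factorial_ne_zero
    rw [← Int.cast_smul_eq_zsmul ℚ, smul_smul]
    simp [this]

namespace Gen

variable {k : ℕ}

/-- The elements of `2^ω` occurring in the index of a generator. -/
def indices : Gen k → Set (ℕ → Bool)
  | x _ η _ => Set.range η
  | y η _ => Set.range η

/-- The generator `x_{m, η̄↾({0,…,k}∖{m}), η_m↾n}`. -/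
def restrict (η : Fin (k + 1) → ℕ → Bool) (n : ℕ) (m : Fin (k + 1)) : Gen k :=
  x m (fun ℓ => η ℓ.1) ((List.range n).map (η m))

theorem mem_genIn_iff {U : Set (ℕ → Bool)} {g : Gen k} : g ∈ genIn k U ↔ g.indices ⊆ U := by
  cases g <;> exact Set.range_subset_iff.symm

theorem indices_restrict_subset (η : Fin (k + 1) → ℕ → Bool) (n : ℕ) (m : Fin (k + 1)) :
    (restrict η n m).indices ⊆ Set.range η := by
  rintro _ ⟨ℓ, rfl⟩
  exact ⟨ℓ.1, rfl⟩

theorem restrict_ne_y (η η' : Fin (k + 1) → ℕ → Bool) (n n' : ℕ) (m : Fin (k + 1)) :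
    restrict η n m ≠ y η' n' := nofun

theorem restrict_eq_restrict {η η' : Fin (k + 1) → ℕ → Bool} {n n' : ℕ} {m m' : Fin (k + 1)}
    (h : restrict η n m = restrict η' n' m') :
    m = m' ∧ n = n' ∧ (∀ ℓ, ℓ ≠ m → η ℓ = η' ℓ) ∧
      (List.range n).map (η m) = (List.range n).map (η' m) := by
  unfold restrict at h
  injection h with h1 h2 h3
  subst h1
  have hn : n = n' := by simpa using congrArg List.length h3
  subst hn
  exact ⟨rfl, rfl, fun ℓ hℓ => congrFun (eq_of_heq h2) ⟨ℓ, hℓ⟩, h3⟩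

end Gen

theorem factorial_zsmul_genMk_y (k : ℕ) (η : Fin (k + 1) → ℕ → Bool) (n : ℕ) :
    (n.factorial : ℤ) • genMk k (.y η (n + 1)) =
      genMk k (.y η n) + ∑ m, genMk k (Gen.restrict η n m) := by
  have h : (QuotientAddGroup.mk' (relSubgroup k)) (relGk k η n) = 0 :=
    (QuotientAddGroup.eq_zero_iff _).2 (AddSubgroup.subset_closure ⟨η, n, rfl⟩)
  rw [relGk, map_sub, map_sub, map_zsmul, map_sum, sub_sub, sub_eq_zero] at h
  exact h

/-- A function on the generators respecting the relations extends to `G_k`. -/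
theorem exists_hom_of_factorial_zsmul {k : ℕ} {M : Type*} [AddCommGroup M] (φ : Gen k → M)
    (h : ∀ η n, (n.factorial : ℤ) • φ (.y η (n + 1)) =
      φ (.y η n) + ∑ m, φ (Gen.restrict η n m)) :
    ∃ Φ : Gk k →+ M, ∀ g, Φ (genMk k g) = φ g := by
  refine ⟨QuotientAddGroup.lift (relSubgroup k) (FreeAbelianGroup.lift φ) ?_, fun g => ?_⟩
  · refine (AddSubgroup.closure_le _).2 ?_
    rintro _ ⟨η, n, rfl⟩
    have := h η n
    simp only [Gen.restrict, natCast_zsmul] at this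
    simp [relGk, this, AddMonoidHom.mem_ker]
  · exact FreeAbelianGroup.lift_apply_of φ g

/-- The tuples in `U ∪ u` in which every element of `u` occurs. -/
def coveringTuples (k : ℕ) (U u : Set (ℕ → Bool)) : Set (Fin (k + 1) → ℕ → Bool) :=
  {η | Set.range η ⊆ U ∪ u ∧ u ⊆ Set.range η}

/-- A well-order on the covering tuples, together with a direction `dir t` for each covering
tuple `t` such that `t` still covers `u` without that coordinate, and such that from `bound t`
on the initial segments of that coordinate separate `t` from its predecessors in that
direction. -/
structure PivotSystem (k : ℕ) (U u : Set (ℕ → Bool)) where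
  rel : coveringTuples k U u → coveringTuples k U u → Prop
  isWellOrder : IsWellOrder _ rel
  dir : coveringTuples k U u → Fin (k + 1)
  bound : coveringTuples k U u → ℕ
  covers : ∀ t, ∀ a ∈ u, ∃ ℓ, ℓ ≠ dir t ∧ t.1 ℓ = a
  separates : ∀ t t', rel t' t → (∀ ℓ, ℓ ≠ dir t → t'.1 ℓ = t.1 ℓ) → ∀ n ≥ bound t,
    (List.range n).map (t'.1 (dir t)) ≠ (List.range n).map (t.1 (dir t))

open Cardinal in
theorem nonempty_pivotSystem (k : ℕ) (U u : Set (ℕ → Bool)) (hufin : u.Finite)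
    (hucard : hufin.toFinset.card ≤ k)
    (hU : Cardinal.mk U ≤ Cardinal.aleph (k - hufin.toFinset.card)) :
    Nonempty (PivotSystem k U u) := by
  classical
  obtain ⟨j, hj⟩ := Nat.exists_eq_add_of_le hucard
  have hV : #(U ∪ u : Set (ℕ → Bool)) ≤ ℵ_ j := by
    have hsub : ((k : Ordinal) - (hufin.toFinset.card : Ordinal)) = (j : Ordinal) := by
      rw [hj, Nat.cast_add, Ordinal.add_sub_cancel]
    rw [hsub] at hU
    exact (mk_union_le _ _).trans (add_le_of_le (aleph0_le_aleph _) hU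
      ((hufin.lt_aleph0).le.trans (aleph0_le_aleph _)))
  obtain ⟨r, hr, hfin⟩ := exists_wellOrder_finite_predecessors (ι := Fin (k + 1)) j _ hV
  let e (t : coveringTuples k U u) (ℓ : Fin (k + 1)) : (U ∪ u : Set (ℕ → Bool)) :=
    ⟨t.1 ℓ, t.2.1 ⟨ℓ, rfl⟩⟩
  have he : e.Injective := fun t t' h =>
    Subtype.ext (funext fun ℓ => congrArg Subtype.val (congrFun h ℓ))
  have hex (t : coveringTuples k U u) : ∃ (m : Fin (k + 1)) (N : ℕ),
      (∀ a ∈ u, ∃ ℓ, ℓ ≠ m ∧ t.1 ℓ = a) ∧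
      ∀ t', r (e t') (e t) → (∀ ℓ, ℓ ≠ m → t'.1 ℓ = t.1 ℓ) → ∀ n ≥ N,
        (List.range n).map (t'.1 m) ≠ (List.range n).map (t.1 m) := by
    have hcov (a : ℕ → Bool) (ha : a ∈ u) : ∃ ℓ, t.1 ℓ = a := t.2.2 ha
    choose! s hs using hcov
    obtain ⟨m, hm, hmfin⟩ := hfin (e t) (hufin.toFinset.image s)ᶜ (by
      have := Finset.card_image_le (s := hufin.toFinset) (f := s)
      rw [Finset.card_compl, Fintype.card_fin]
      omega)
    have hne (t') (h : r (e t') (e t) ∧ ∀ ℓ, ℓ ≠ m → e t' ℓ = e t ℓ) :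
        ∃ i, t'.1 m i ≠ t.1 m i := by
      by_contra! hcon
      have heq : e t' = e t := funext fun ℓ => by
        by_cases hℓ : ℓ = m
        · exact Subtype.ext (hℓ ▸ funext hcon)
        · exact h.2 ℓ hℓ
      exact irrefl_of r (e t) (heq ▸ h.1)
    choose! d hd using hne
    obtain ⟨N, hN⟩ := ((hmfin.preimage he.injOn).image d).bddAbove
    refine ⟨m, N + 1, fun a ha => ⟨s a, ?_, hs a ha⟩, fun t' hlt hoff n hn heq => ?_⟩
    · rintro rfl
      simp only [Finset.mem_compl, Finset.mem_image, Set.Finite.mem_toFinset] at hm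
      exact hm ⟨a, ha, rfl⟩
    · have h : r (e t') (e t) ∧ ∀ ℓ, ℓ ≠ m → e t' ℓ = e t ℓ :=
        ⟨hlt, fun ℓ hℓ => Subtype.ext (hoff ℓ hℓ)⟩
      have hdN : d t' ≤ N := hN ⟨t', h, rfl⟩
      exact hd t' h (List.map_inj_left.1 heq _ (List.mem_range.2 (by omega)))
  choose dir bound hcov hsep using hex
  exact ⟨⟨Function.onFun r e, he.isWellOrder r, dir, bound, hcov, hsep⟩⟩

namespace PivotSystem

variable {k : ℕ} {U u : Set (ℕ → Bool)} (S : PivotSystem k U u)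

/-- The pairs of a covering tuple `t` and some `n ≥ bound t`. -/
abbrev Index : Type := {q : coveringTuples k U u × ℕ // S.bound q.1 ≤ q.2}

/-- The generator eliminated by the relation for `t` and `n`. -/
def pivot (q : S.Index) : Gen k := Gen.restrict q.1.1.1 q.1.2 (S.dir q.1.1)

/-- The generators whose images form a basis of `G_{U∪u}/G_{U,u}`. -/
def basisGens : Set (Gen k) :=
  {g | g.indices ⊆ U ∪ u ∧ u ⊆ g.indices ∧ g ∉ Set.range S.pivot ∧
    ∀ (t : coveringTuples k U u) (n : ℕ), g = .y t.1 n → S.bound t ≤ n}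

theorem eq_or_rel_of_pivot_eq_restrict {q : S.Index} {t : coveringTuples k U u} {n : ℕ}
    {m : Fin (k + 1)} (h : S.pivot q = Gen.restrict t.1 n m) :
    q.1.2 = n ∧ S.dir q.1.1 = m ∧ (q.1.1 = t ∨ S.rel q.1.1 t) := by
  obtain ⟨hm, hn, hoff, hlist⟩ := Gen.restrict_eq_restrict h
  refine ⟨hn, hm, ?_⟩
  have := S.isWellOrder
  obtain h | h | h := trichotomous_of S.rel q.1.1 t
  · exact .inr h
  · exact .inl h
  · exact absurd hlist.symm
      (S.separates q.1.1 t h (fun ℓ hℓ => (hoff ℓ hℓ).symm) _ q.2)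

theorem pivot_injective : S.pivot.Injective := by
  intro q q' h
  have := S.isWellOrder
  obtain ⟨hn, -, h1⟩ := S.eq_or_rel_of_pivot_eq_restrict h
  obtain ⟨-, -, h2⟩ := S.eq_or_rel_of_pivot_eq_restrict h.symm
  refine Subtype.ext (Prod.ext ?_ hn)
  obtain h1 | h1 := h1
  · exact h1
  · obtain h2 | h2 := h2
    · exact h2.symm
    · exact absurd h2 (asymm_of S.rel h1)

theorem indices_pivot_subset (q : S.Index) : (S.pivot q).indices ⊆ U ∪ u :=
  (Gen.indices_restrict_subset _ _ _).trans q.1.1.2.1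

theorem subset_indices_pivot (q : S.Index) : u ⊆ (S.pivot q).indices := by
  intro a ha
  obtain ⟨ℓ, hℓ, rfl⟩ := S.covers q.1.1 a ha
  exact ⟨⟨ℓ, hℓ⟩, rfl⟩

theorem y_mem_basisGens (t : coveringTuples k U u) {n : ℕ} (hn : S.bound t ≤ n) :
    Gen.y t.1 n ∈ S.basisGens := by
  refine ⟨t.2.1, t.2.2, fun ⟨q, hq⟩ => Gen.restrict_ne_y _ _ _ _ _ hq, fun t' n' h => ?_⟩
  injection h with h1 h2
  rwa [← Subtype.ext h1, ← h2]

/-- Some homomorphism from `G_k` to a rational vector space vanishes on `G_{U,u}` and sends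
the basis generators to linearly independent vectors. -/
theorem exists_hom_single (hdisj : Disjoint u U) :
    ∃ Φ : Gk k →+ (S.basisGens →₀ ℚ),
      (∀ b : S.basisGens, Φ (genMk k b) = Finsupp.single b 1) ∧
      ∀ z ∈ GUu k U u, Φ z = 0 := by
  classical
  let f (g : Gen k) : S.basisGens →₀ ℚ :=
    if h : g ∈ S.basisGens then Finsupp.single ⟨g, h⟩ 1 else 0
  have := S.isWellOrder
  obtain ⟨φ, hφ, hφp⟩ := exists_solution_of_triangular
    (InvImage.wf (fun q : S.Index => q.1.1) (IsWellFounded.wf (r := S.rel)))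
    S.pivot_injective (fun q => Finset.univ.erase (S.dir q.1.1))
    (fun q m => Gen.restrict q.1.1.1 q.1.2 m)
    (fun q q' m hm h => by
      obtain ⟨-, hdir, h' | h'⟩ := S.eq_or_rel_of_pivot_eq_restrict h
      · exact absurd (h' ▸ hdir).symm (Finset.ne_of_mem_erase hm)
      · exact h') f
    (fun q => (q.1.2.factorial : ℤ) • f (.y q.1.1.1 (q.1.2 + 1)) - f (.y q.1.1.1 q.1.2))
  have hφ0 (g : Gen k) (hg : ¬ u ⊆ g.indices) : φ g = 0 := by
    rw [hφ g]
    · exact dif_neg fun h => hg h.2.1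
    · rintro ⟨q, rfl⟩
      exact hg (S.subset_indices_pivot q)
  have hY (η : Fin (k + 1) → ℕ → Bool) : ∃ Y : ℕ → S.basisGens →₀ ℚ,
      (∀ n, (n.factorial : ℤ) • Y (n + 1) = Y n + ∑ m, φ (Gen.restrict η n m)) ∧
      (∀ h : η ∈ coveringTuples k U u, ∀ n ≥ S.bound ⟨η, h⟩, Y n = f (.y η n)) ∧
      (¬ u ⊆ Set.range η → Y = 0) := by
    by_cases h : η ∈ coveringTuples k U u
    · obtain ⟨Y, hY, hYf⟩ := exists_seq_extending (fun n => ∑ m, φ (Gen.restrict η n m))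
        (S.bound ⟨η, h⟩) (fun n => f (.y η n)) fun n hn => by
          have := hφp ⟨(⟨η, h⟩, n), hn⟩
          rw [← Finset.add_sum_erase _ _ (Finset.mem_univ (S.dir ⟨η, h⟩)), ← add_assoc,
            ← sub_eq_iff_eq_add, ← sub_eq_iff_eq_add', sub_right_comm]
          exact this.symm
      exact ⟨Y, hY, fun _ => hYf, fun h' => absurd h.2 h'⟩
    · obtain ⟨Y, hY, hY0⟩ := exists_seq_of_rat fun n => ∑ m, φ (Gen.restrict η n m)
      refine ⟨Y, hY, fun h' => absurd h' h, fun h' => hY0 (funext fun n => ?_)⟩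
      exact Finset.sum_eq_zero fun m _ =>
        hφ0 _ fun hu => h' (hu.trans (Gen.indices_restrict_subset _ _ _))
  choose Y hYrec hYf hY0 using hY
  let φ' : Gen k → S.basisGens →₀ ℚ
    | .x m η ν => φ (.x m η ν)
    | .y η n => Y η n
  obtain ⟨Φ, hΦ⟩ := exists_hom_of_factorial_zsmul φ' fun η n => hYrec η n
  refine ⟨Φ, fun ⟨b, hb⟩ => ?_, fun z hz => ?_⟩
  · have hfb : f b = Finsupp.single ⟨b, hb⟩ 1 := dif_pos hb
    rw [hΦ, ← hfb]
    cases b with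
    | x m η ν => exact hφ _ hb.2.2.1
    | y η n => exact hYf η ⟨hb.1, hb.2.1⟩ n (hb.2.2.2 ⟨η, _⟩ n rfl)
  · have hle : GUu k U u ≤ Φ.ker := by
      refine iSup₂_le fun a ha => (AddSubgroup.closure_le _).2 ?_
      rintro _ ⟨g, hg, rfl⟩
      have hnot : ¬ u ⊆ g.indices := fun h => by
        obtain h' | h' := Gen.mem_genIn_iff.1 hg (h ha)
        · exact Set.disjoint_left.1 hdisj ha h'
        · exact h'.2 rfl
      refine (hΦ g).trans ?_
      cases g with
      | x m η ν => exact hφ0 _ hnot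
      | y η n => exact congrFun (hY0 η hnot) n
    exact hle hz

/-- The group `G_{U∪u}` is generated by `G_{U,u}` and the basis generators. -/
theorem GU_le_GUu_sup_closure : GU k (U ∪ u) ≤ GUu k U u ⊔ AddSubgroup.closure (genMk k '' S.basisGens) := by
  set H := GUu k U u ⊔ AddSubgroup.closure (genMk k '' S.basisGens)
  have hbasis (g : Gen k) (hg : g ∈ S.basisGens) : genMk k g ∈ H :=
    (le_sup_right : _ ≤ H) (AddSubgroup.subset_closure ⟨g, hg, rfl⟩)
  have hsmall (g : Gen k) (hg : g.indices ⊆ U ∪ u) (hu : ¬ u ⊆ g.indices) : genMk k g ∈ H := by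
    obtain ⟨a, ha, hag⟩ := Set.not_subset.1 hu
    refine (le_sup_left : _ ≤ H) ((le_iSup₂_of_le a ha le_rfl :
      GU k (U ∪ (u \ {a})) ≤ GUu k U u) (AddSubgroup.subset_closure ⟨g, ?_, rfl⟩))
    refine Gen.mem_genIn_iff.2 fun b hb => (hg hb).imp id fun h => ⟨h, ?_⟩
    rintro rfl
    exact hag hb
  have hrest (η : Fin (k + 1) → ℕ → Bool) (hη : Set.range η ⊆ U ∪ u) (n : ℕ) (m : Fin (k + 1))
      (hp : ∀ q, S.pivot q = Gen.restrict η n m → genMk k (S.pivot q) ∈ H) :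
      genMk k (Gen.restrict η n m) ∈ H := by
    have hsub := (Gen.indices_restrict_subset η n m).trans hη
    by_cases hu : u ⊆ (Gen.restrict η n m).indices
    · by_cases hq : Gen.restrict η n m ∈ Set.range S.pivot
      · obtain ⟨q, hq⟩ := hq
        exact hq ▸ hp q hq
      · exact hbasis _ ⟨hsub, hu, hq, fun t n h => absurd h (Gen.restrict_ne_y _ _ _ _ _)⟩
    · exact hsmall _ hsub hu
  have := S.isWellOrder
  have hpivot (t : coveringTuples k U u) :
      ∀ n (hn : S.bound t ≤ n), genMk k (S.pivot ⟨(t, n), hn⟩) ∈ H := by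
    induction t using (IsWellFounded.wf (r := S.rel)).induction with
    | _ t ih =>
    intro n hn
    have hrel := factorial_zsmul_genMk_y k t.1 n
    rw [← Finset.add_sum_erase _ _ (Finset.mem_univ (S.dir t)), ← add_assoc,
      ← sub_eq_iff_eq_add, ← sub_eq_iff_eq_add'] at hrel
    have hpiv : genMk k (S.pivot ⟨(t, n), hn⟩) = _ := hrel.symm
    rw [hpiv]
    refine H.sub_mem (H.sub_mem (H.zsmul_mem (hbasis _ (S.y_mem_basisGens t (by omega))) _)
      (H.sum_mem fun m hm => hrest _ t.2.1 n m fun q hq => ?_))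
      (hbasis _ (S.y_mem_basisGens t hn))
    obtain ⟨-, hdir, h | h⟩ := S.eq_or_rel_of_pivot_eq_restrict hq
    · exact absurd (h ▸ hdir).symm (Finset.ne_of_mem_erase hm)
    · exact ih _ h _ q.2
  have hy (t : coveringTuples k U u) (d : ℕ) :
      ∀ n, S.bound t ≤ n + d → genMk k (.y t.1 n) ∈ H := by
    induction d with
    | zero => exact fun n hn => hbasis _ (S.y_mem_basisGens t hn)
    | succ d ih =>
      intro n hn
      rw [eq_sub_of_add_eq (factorial_zsmul_genMk_y k t.1 n).symm]
      exact H.sub_mem (H.zsmul_mem (ih _ (by omega)) _)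
        (H.sum_mem fun m _ => hrest _ t.2.1 n m fun q _ => hpivot _ _ q.2)
  refine (AddSubgroup.closure_le _).2 ?_
  rintro _ ⟨g, hg, rfl⟩
  have hg := Gen.mem_genIn_iff.1 hg
  by_cases hu : u ⊆ g.indices
  · by_cases hq : g ∈ Set.range S.pivot
    · obtain ⟨q, rfl⟩ := hq
      exact hpivot _ _ q.2
    · cases g with
      | x m η ν => exact hbasis _ ⟨hg, hu, hq, nofun⟩
      | y η n => exact hy ⟨η, hg, hu⟩ _ n (Nat.le_add_left _ _)
  · exact hsmall g hg hu

end PivotSystem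
open Cardinal in
/-- If `u ⊆ 2^ω ∖ U` is nonempty and finite with `|u| ≤ k`, and `|U| ≤ ℵ_{k−|u|}`, then
the quotient `G_{U∪u}/G_{U,u}` is a free abelian group. -/
theorem quotient_GUu_free (k : ℕ) (U u : Set (ℕ → Bool)) (hufin : u.Finite)
    (hune : u.Nonempty) (hdisj : Disjoint u U)
    (hucard : hufin.toFinset.card ≤ k)
    (hU : Cardinal.mk U ≤ Cardinal.aleph (k - hufin.toFinset.card)) :
    Module.Free ℤ
      ((GU k (U ∪ u)) ⧸ ((GUu k U u).addSubgroupOf (GU k (U ∪ u)))) := by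
  obtain ⟨S⟩ := nonempty_pivotSystem k U u hufin hucard hU
  obtain ⟨Φ, hΦ, hΦ0⟩ := S.exists_hom_single hdisj
  set G := GU k (U ∪ u)
  set K := (GUu k U u).addSubgroupOf G
  have hmem (b : S.basisGens) : genMk k b ∈ G :=
    AddSubgroup.subset_closure ⟨b, Gen.mem_genIn_iff.2 b.2.1, rfl⟩
  let v (b : S.basisGens) : G ⧸ K := QuotientAddGroup.mk ⟨genMk k b, hmem b⟩
  let Ψ : G ⧸ K →+ (S.basisGens →₀ ℚ) :=
    QuotientAddGroup.lift K (Φ.comp G.subtype) fun z hz => hΦ0 z hz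
  have hli : LinearIndependent ℤ v := by
    refine LinearIndependent.of_comp Ψ.toIntLinearMap ?_
    have hcomp : Ψ.toIntLinearMap ∘ v = fun b => Finsupp.single b (1 : ℚ) := funext hΦ
    rw [hcomp]
    exact (Finsupp.linearIndependent_single_one ℚ _).restrict_scalars' ℤ
  have hspan : ⊤ ≤ Submodule.span ℤ (Set.range v) := by
    rintro z -
    obtain ⟨⟨z, hz⟩, rfl⟩ := QuotientAddGroup.mk_surjective z
    obtain ⟨a, ha, b, hb, rfl⟩ := AddSubgroup.mem_sup.1 (S.GU_le_GUu_sup_closure hz)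
    have hspanb : ∃ hbG : b ∈ G, (QuotientAddGroup.mk ⟨b, hbG⟩ : G ⧸ K) ∈
        Submodule.span ℤ (Set.range v) := by
      clear hz
      induction hb using AddSubgroup.closure_induction with
      | mem _ h =>
        obtain ⟨g, hg, rfl⟩ := h
        exact ⟨hmem ⟨g, hg⟩, Submodule.subset_span ⟨⟨g, hg⟩, rfl⟩⟩
      | zero => exact ⟨G.zero_mem, Submodule.zero_mem _⟩
      | add _ _ _ _ h h' =>
        exact ⟨G.add_mem h.fst h'.fst, Submodule.add_mem _ h.snd h'.snd⟩
      | neg _ _ h => exact ⟨G.neg_mem h.fst, Submodule.neg_mem _ h.snd⟩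
    obtain ⟨hbG, hbspan⟩ := hspanb
    convert hbspan using 1
    refine QuotientAddGroup.eq.2 (AddSubgroup.mem_addSubgroupOf.2 ?_)
    simpa using ha
  exact Module.Free.of_basis (Module.Basis.mk hli hspan)
end

section
/- If U ⊆ 2^ω has cardinality at most ℵ_k, then the subgroup G_U of G_k is a free abelian group. -/
universe u v

/-- A set of size at most `κ⁺` carries an ordinal ranking, injective on it, whose closed
initial segments have size at most `κ`. -/
theorem exists_injOn_ordinal_mk_segment_le {α : Type} (κ : Cardinal.{0})
    (hκ : Cardinal.aleph0 ≤ κ) (U : Set α) (hU : Cardinal.mk U ≤ Order.succ κ) :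
    ∃ o : α → Ordinal.{0}, Set.InjOn o U ∧
      ∀ γ ∈ U, Cardinal.mk {a | a ∈ U ∧ o a ≤ o γ} ≤ κ := by
  classical
  obtain ⟨_, _, h⟩ := Cardinal.exists_ord_eq_type_lt U
  have hinj : Set.InjOn
      (fun a => if h : a ∈ U then Ordinal.typein (α := U) (· < ·) ⟨a, h⟩ else 0) U := by
    intro a ha b hb hab
    simpa [ha, hb] using hab
  refine ⟨_, hinj, fun γ hγ => ?_⟩
  have hsub : {a | a ∈ U ∧
      (fun a => if h : a ∈ U then Ordinal.typein (α := U) (· < ·) ⟨a, h⟩ else 0) a ≤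
        (fun a => if h : a ∈ U then Ordinal.typein (α := U) (· < ·) ⟨a, h⟩ else 0) γ} ⊆
      insert γ (Subtype.val '' Set.Iio (⟨γ, hγ⟩ : U)) := by
    rintro a ⟨ha, hle⟩
    rcases hle.lt_or_eq with hlt | heq
    · refine Or.inr ⟨⟨a, ha⟩, ?_, rfl⟩
      simpa [ha, hγ] using hlt
    · exact Or.inl (hinj ha hγ heq)
  have hlt := (Cardinal.mk_Iio_lt (⟨γ, hγ⟩ : U) h).trans_le hU
  calc _ ≤ _ := Cardinal.mk_le_mk_of_subset hsub
    _ ≤ _ := Cardinal.mk_insert_le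
    _ ≤ κ + κ := add_le_add (Cardinal.mk_image_le.trans (Order.lt_succ_iff.1 hlt))
        (Cardinal.one_le_aleph0.trans hκ)
    _ = κ := Cardinal.add_eq_self hκ

/-- A nonempty finite tuple in a linear order has a first position at which its maximum is attained. -/
theorem exists_first_max {n : ℕ} {β : Type*} [LinearOrder β] (t : Fin (n + 1) → β) :
    ∃ p, (∀ l, t l ≤ t p) ∧ ∀ q, (∀ l, t l ≤ t q) → p ≤ q := by
  obtain ⟨q, hq⟩ := Finite.exists_max t
  have hne : {p | ∀ l, t l ≤ t p}.Nonempty := ⟨q, hq⟩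
  exact ⟨wellFounded_lt.min _ hne, wellFounded_lt.min_mem _ hne,
    fun r hr => wellFounded_lt.min_le (s := {p | ∀ l, t l ≤ t p}) hr⟩

/-- A map to a well-order that is injective on `S` can be replaced, up to order equivalence on
`S`, by a ranking with values in the ordinals of the universe of its domain. -/
theorem exists_ordinal_rank {T : Type u} {β : Type v} [LinearOrder β] [WellFoundedLT β]
    (S : Set T) (g : T → β) (hg : Set.InjOn g S) :
    ∃ f : T → Ordinal.{u}, Set.InjOn f S ∧ ∀ a ∈ S, ∀ b ∈ S, f a < f b ↔ g a < g b := by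
  classical
  let e : (fun a b : S => g a < g b) ↪r ((· < ·) : β → β → Prop) :=
    ⟨⟨fun a => g a, fun a b hab => Subtype.ext (hg a.2 b.2 hab)⟩, Iff.rfl⟩
  have : IsWellOrder S (fun a b : S => g a < g b) := e.isWellOrder
  refine ⟨fun a => if h : a ∈ S then Ordinal.typein (fun a b : S => g a < g b) ⟨a, h⟩ else 0,
    fun a ha b hb hab => ?_, fun a ha b hb => ?_⟩
  · simpa [ha, hb] using hab
  · simp [ha, hb]

/-- If `#U ≤ ℵ_k`, the tuples in `U^{k+1}` can be well-ordered so that each of them has a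
coordinate such that only finitely many earlier tuples differ from it in that coordinate only. -/
theorem exists_wellOrder_finite_line {α : Type} (k : ℕ) (U : Set α)
    (hU : Cardinal.mk U ≤ Cardinal.aleph k) :
    ∃ f : (Fin (k + 1) → α) → Ordinal.{0},
      Set.InjOn f {η | ∀ l, η l ∈ U} ∧
      ∀ η, (∀ l, η l ∈ U) → ∃ m,
        {η' | (∀ l, η' l ∈ U) ∧ f η' < f η ∧ ∀ l, l ≠ m → η' l = η l}.Finite := by
  classical
  induction k generalizing U with
  | zero =>
    have hc : Countable U := by simpa using hU
    obtain ⟨e, he⟩ := Set.countable_iff_exists_injOn.1 (Set.countable_coe_iff.1 hc)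
    have hinj : Set.InjOn (fun η : Fin 1 → α => e (η 0)) {η | ∀ l, η l ∈ U} := by
      intro a ha b hb hab
      funext l
      rw [Subsingleton.elim l 0]
      exact he (ha 0) (hb 0) hab
    refine ⟨fun η => e (η 0),
      fun a ha b hb hab => hinj ha hb (Nat.cast_injective hab), fun η _ => ⟨0, ?_⟩⟩
    refine Set.Finite.of_finite_image
      ((Set.finite_Iio (e (η 0))).subset ?_) (hinj.mono fun η' h => h.1)
    rintro _ ⟨η', h, rfl⟩
    exact Nat.cast_lt.1 h.2.1
  | succ k ih =>
    have hU' : Cardinal.mk U ≤ Order.succ (Cardinal.aleph k) := by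
      rw [Cardinal.succ_aleph]
      exact_mod_cast hU
    obtain ⟨o, ho, hseg⟩ :=
      exists_injOn_ordinal_mk_segment_le _ (Cardinal.aleph0_le_aleph k) U hU'
    choose! F hF hfin using fun γ hγ => ih {a | a ∈ U ∧ o a ≤ o γ} (hseg γ hγ)
    choose p hmax hfirst using fun η : Fin (k + 2) → α => exists_first_max fun l => o (η l)
    obtain ⟨f, hf, hlt⟩ := exists_ordinal_rank {η : Fin (k + 2) → α | ∀ l, η l ∈ U}
      (fun η => toLex (o (η (p η)), toLex (p η, F (η (p η)) fun j => η ((p η).succAbove j))))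
      (by
        intro a ha b hb hab
        simp only [EmbeddingLike.apply_eq_iff_eq, Prod.mk.injEq] at hab
        obtain ⟨h₁, h₂, h₃⟩ := hab
        have h₁ := ho (ha _) (hb _) h₁
        rw [h₁, h₂] at h₃
        have h₄ := hF _ (hb (p b)) (fun j => ⟨ha _, by rw [← h₁]; exact hmax a _⟩)
          (fun j => ⟨hb _, hmax b _⟩) h₃
        funext l
        rcases Fin.eq_self_or_eq_succAbove (p b) l with rfl | ⟨j, rfl⟩
        · rw [← h₁, h₂]
        · exact congrFun h₄ j)
    refine ⟨f, hf, fun η hη => ?_⟩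
    obtain ⟨m, hm⟩ := hfin _ (hη (p η)) (fun j => η ((p η).succAbove j))
      fun j => ⟨hη _, hmax η _⟩
    refine ⟨(p η).succAbove m, ((hm.image fun t => (p η).insertNth (η (p η)) t).insert
      (Function.update η ((p η).succAbove m) (η (p η)))).subset ?_⟩
    rintro η' ⟨hη', hlt', hag⟩
    rw [hlt _ hη' _ hη] at hlt'
    have hp : η' (p η) = η (p η) := hag _ (Fin.succAbove_ne _ _).symm
    have ho_le : o (η' (p η')) ≤ o (η (p η)) := by
      rcases Prod.Lex.toLex_lt_toLex.1 hlt' with h | h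
      exacts [h.le, h.1.le]
    have ho_eq : o (η' (p η')) = o (η (p η)) := le_antisymm ho_le (hp ▸ hmax η' (p η))
    have hval : η' (p η') = η (p η) := ho (hη' _) (hη _) ho_eq
    by_cases hpm : p η' = (p η).succAbove m
    · left
      funext l
      by_cases hl : l = (p η).succAbove m
      · rw [hl, Function.update_self, ← hpm, hval]
      · rw [Function.update_of_ne hl, hag l hl]
    · have hpp : p η' = p η := by
        apply le_antisymm
        · exact hfirst η' _ fun l => by rw [hp, ← ho_eq]; exact hmax η' l
        · exact hfirst η _ fun l => by rw [← hag _ hpm, ho_eq]; exact hmax η l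
      right
      refine ⟨fun j => η' ((p η).succAbove j), ⟨fun j => ⟨hη' _, ?_⟩, ?_, fun l hl => ?_⟩, ?_⟩
      · rw [← ho_eq]
        exact hmax η' _
      · rw [Prod.Lex.toLex_lt_toLex] at hlt'
        simpa [hpp, hp, Prod.Lex.toLex_lt_toLex] using hlt'
      · exact hag _ fun h => hl (Fin.succAbove_right_injective h)
      · rw [← hp]
        exact Fin.insertNth_self_removeNth (p η) η'

/-- A triangular family, as witnessed by linear functionals, is linearly independent. -/
theorem linearIndependent_of_triangular {ι M α : Type*} [AddCommGroup M] [LinearOrder α]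
    (v : ι → M) (ρ : ι → α) (φ : ι → M →+ ℚ) (hdiag : ∀ i, φ i (v i) ≠ 0)
    (hlower : ∀ i j, j ≠ i → ρ j ≤ ρ i → φ i (v j) = 0) : LinearIndependent ℤ v := by
  rw [linearIndependent_iff]
  intro l hl
  by_contra hne
  obtain ⟨i, hi, hmax⟩ := l.support.exists_max_image ρ (Finsupp.support_nonempty_iff.2 hne)
  have h := congrArg (φ i) hl
  rw [Finsupp.linearCombination_apply, Finsupp.sum, map_sum, map_zero,
    Finset.sum_eq_single i] at h
  · rw [map_zsmul, smul_eq_zero] at h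
    exact h.elim (Finsupp.mem_support_iff.1 hi) (hdiag i)
  · intro j hj hji
    rw [map_zsmul, hlower i j hji (hmax j hj), smul_zero]
  · exact fun h => absurd hi h

/-- The `x`-generator attached to the coordinate `m` in the relation indexed by `η` and `n`. -/
def xGen {k : ℕ} (m : Fin (k + 1)) (η : Fin (k + 1) → ℕ → Bool) (n : ℕ) : Gen k :=
  .x m (fun ℓ => η ℓ.1) ((List.range n).map (η m))

theorem xGen_eq_iff {k : ℕ} {m m' : Fin (k + 1)} {η η' : Fin (k + 1) → ℕ → Bool} {n n' : ℕ} :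
    xGen m η n = xGen m' η' n' ↔
      m = m' ∧ n = n' ∧ (∀ l, l ≠ m → η l = η' l) ∧ ∀ i < n, η m i = η' m i := by
  constructor
  · intro h
    simp only [xGen, Gen.x.injEq] at h
    obtain ⟨rfl, h₂, h₃⟩ := h
    obtain rfl : n = n' := by simpa using congrArg List.length h₃
    exact ⟨rfl, rfl, fun l hl => congrFun (eq_of_heq h₂) ⟨l, hl⟩, by simpa using h₃⟩
  · rintro ⟨rfl, rfl, h₁, h₂⟩
    simp only [xGen, Gen.x.injEq, true_and]
    exact ⟨heq_of_eq (funext fun l => h₁ l.1 l.2), by simpa using h₂⟩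

theorem xGen_mem_genIn {k : ℕ} {U : Set (ℕ → Bool)} {η : Fin (k + 1) → ℕ → Bool}
    (hη : ∀ l, η l ∈ U) (m : Fin (k + 1)) (n : ℕ) : xGen m η n ∈ genIn k U :=
  fun l => hη l.1

theorem factorial_smul_genMk_y {k : ℕ} (η : Fin (k + 1) → ℕ → Bool) (n : ℕ) :
    (n.factorial : ℤ) • genMk k (.y η (n + 1)) =
      genMk k (.y η n) + ∑ m, genMk k (xGen m η n) := by
  have h : (QuotientAddGroup.mk' (relSubgroup k)) (relGk k η n) = 0 :=
    (QuotientAddGroup.eq_zero_iff _).2 (AddSubgroup.subset_closure ⟨η, n, rfl⟩)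
  simp only [relGk, map_sub, map_zsmul, map_sum] at h
  rw [sub_sub, sub_eq_zero] at h
  exact h

/-- The values on the generators of the homomorphism `G_k → ℚ` determined by its values `X` on
the `x`-generators and `Y` on the generators `y_{η̄,0}`. -/
noncomputable def genVal {k : ℕ} (X : Gen k → ℚ) (Y : (Fin (k + 1) → ℕ → Bool) → ℚ) :
    Gen k → ℚ
  | .x m η ν => X (.x m η ν)
  | .y η n => Nat.rec (Y η) (fun i r => (r + ∑ m, X (xGen m η i)) / i.factorial) n

theorem genVal_y_succ {k : ℕ} (X : Gen k → ℚ) (Y : (Fin (k + 1) → ℕ → Bool) → ℚ)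
    (η : Fin (k + 1) → ℕ → Bool) (n : ℕ) :
    genVal X Y (.y η (n + 1)) =
      (genVal X Y (.y η n) + ∑ m, X (xGen m η n)) / n.factorial :=
  rfl

/-- A homomorphism `G_k → ℚ` with prescribed values on the `x`-generators and on the generators
`y_{η̄,0}`. -/
noncomputable def homRat {k : ℕ} (X : Gen k → ℚ) (Y : (Fin (k + 1) → ℕ → Bool) → ℚ) :
    Gk k →+ ℚ :=
  QuotientAddGroup.lift (relSubgroup k) (FreeAbelianGroup.lift (genVal X Y)) <| by
    rw [relSubgroup, AddSubgroup.closure_le]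
    rintro _ ⟨η, n, rfl⟩
    simp only [SetLike.mem_coe, AddMonoidHom.mem_ker, relGk, map_sub, map_zsmul, map_sum,
      FreeAbelianGroup.lift_apply_of, genVal_y_succ, zsmul_eq_mul, Int.cast_natCast]
    rw [mul_div_cancel₀ _ (Nat.cast_ne_zero.2 n.factorial_ne_zero)]
    simp only [genVal, xGen]
    ring

theorem homRat_genMk {k : ℕ} (X : Gen k → ℚ) (Y : (Fin (k + 1) → ℕ → Bool) → ℚ) (g : Gen k) :
    homRat X Y (genMk k g) = genVal X Y g :=
  FreeAbelianGroup.lift_apply_of _ _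

theorem genVal_y_eq_zero {k : ℕ} {X : Gen k → ℚ} {Y : (Fin (k + 1) → ℕ → Bool) → ℚ}
    {η : Fin (k + 1) → ℕ → Bool} {n : ℕ} (hY : Y η = 0)
    (hX : ∀ i < n, ∀ m, X (xGen m η i) = 0) : genVal X Y (.y η n) = 0 := by
  induction n with
  | zero => exact hY
  | succ n ih =>
    rw [genVal_y_succ, ih fun i hi => hX i (hi.trans n.lt_succ_self),
      Finset.sum_eq_zero fun m _ => hX n n.lt_succ_self m, add_zero, zero_div]

theorem genVal_zero_y_ne_zero {k : ℕ} {Y : (Fin (k + 1) → ℕ → Bool) → ℚ}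
    {η : Fin (k + 1) → ℕ → Bool} (hY : Y η ≠ 0) (n : ℕ) : genVal 0 Y (.y η n) ≠ 0 := by
  induction n with
  | zero => exact hY
  | succ n ih =>
    rw [genVal_y_succ]
    simpa using ⟨ih, n.factorial_ne_zero⟩

/-- The `x`-generators `x_{M η̄, η̄, η_{M η̄}↾n}` with `η̄ ∈ U^{k+1}` and `n ≥ N η̄`, which the
relations allow to eliminate. -/
def redundantGens {k : ℕ} (U : Set (ℕ → Bool)) (M : (Fin (k + 1) → ℕ → Bool) → Fin (k + 1))
    (N : (Fin (k + 1) → ℕ → Bool) → ℕ) : Set (Gen k) :=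
  {g | ∃ η, (∀ l, η l ∈ U) ∧ ∃ n, N η ≤ n ∧ g = xGen (M η) η n}

/-- The generators of `G_U` that remain after eliminating `redundantGens U M N` and the
generators `y_{η̄,n}` with `n < N η̄`. -/
def basisGens {k : ℕ} (U : Set (ℕ → Bool)) (M : (Fin (k + 1) → ℕ → Bool) → Fin (k + 1))
    (N : (Fin (k + 1) → ℕ → Bool) → ℕ) : Set (Gen k) :=
  {g | g ∈ genIn k U ∧ g ∉ redundantGens U M N ∧ ∀ η n, g = .y η n → N η ≤ n}

/-- Earlier tuples in `U^{k+1}` that differ from `η̄` at most in the coordinate `M η̄` are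
separated from `η̄` by the first `N η̄` digits of that coordinate. -/
def Separates {k : ℕ} (U : Set (ℕ → Bool)) (f : (Fin (k + 1) → ℕ → Bool) → Ordinal.{0})
    (M : (Fin (k + 1) → ℕ → Bool) → Fin (k + 1)) (N : (Fin (k + 1) → ℕ → Bool) → ℕ) : Prop :=
  ∀ η, (∀ l, η l ∈ U) → ∀ η', (∀ l, η' l ∈ U) → f η' < f η →
    ∀ n, N η ≤ n → ∀ m, xGen m η' n ≠ xGen (M η) η n

theorem exists_separates {k : ℕ} {U : Set (ℕ → Bool)} (hU : Cardinal.mk U ≤ Cardinal.aleph k) :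
    ∃ (f : (Fin (k + 1) → ℕ → Bool) → Ordinal.{0}) (M : _) (N : _),
      Set.InjOn f {η | ∀ l, η l ∈ U} ∧ Separates U f M N := by
  obtain ⟨f, hf, hfin⟩ := exists_wellOrder_finite_line k U hU
  choose! M hM using hfin
  have hN : ∀ η, (∀ l, η l ∈ U) → ∃ N : ℕ, ∀ η', (∀ l, η' l ∈ U) → f η' < f η →
      (∀ l, l ≠ M η → η' l = η l) → ∃ i < N, η' (M η) i ≠ η (M η) i := by
    intro η hη
    have hdiff : ∀ η', (∀ l, η' l ∈ U) ∧ f η' < f η ∧ (∀ l, l ≠ M η → η' l = η l) →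
        ∃ i, η' (M η) i ≠ η (M η) i := by
      rintro η' ⟨-, hlt, hag⟩
      by_contra! hcon
      refine hlt.ne (congrArg f (funext fun l => ?_))
      by_cases hl : l = M η
      · rw [hl]
        exact funext hcon
      · exact hag l hl
    choose! i hi using hdiff
    obtain ⟨b, hb⟩ := ((hM η hη).image i).bddAbove
    exact ⟨b + 1, fun η' h₁ h₂ h₃ => ⟨i η',
      Nat.lt_succ_of_le (hb ⟨η', ⟨h₁, h₂, h₃⟩, rfl⟩), hi η' ⟨h₁, h₂, h₃⟩⟩⟩
  choose! N hN using hN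
  refine ⟨f, M, N, hf, fun η hη η' hη' hlt n hn m heq => ?_⟩
  obtain ⟨rfl, -, hag, hdig⟩ := xGen_eq_iff.1 heq
  obtain ⟨i, hi, hne⟩ := hN η hη η' hη' hlt hag
  exact hne (hdig i (hi.trans_le hn))

theorem linearIndependent_basisGens {k : ℕ} {U : Set (ℕ → Bool)}
    {f : (Fin (k + 1) → ℕ → Bool) → Ordinal.{0}}
    {M : (Fin (k + 1) → ℕ → Bool) → Fin (k + 1)} {N : (Fin (k + 1) → ℕ → Bool) → ℕ}
    (hf : Set.InjOn f {η | ∀ l, η l ∈ U}) (hsep : Separates U f M N) :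
    LinearIndependent ℤ fun g : basisGens U M N => genMk k g := by
  classical
  let ρ : Gen k → WithBot (Ordinal.{0} ×ₗ ℕ)
    | .x _ _ _ => ⊥
    | .y η n => (toLex (f η, n) : Ordinal.{0} ×ₗ ℕ)
  let φ : Gen k → Gk k →+ ℚ
    | .x m η ν => homRat (Pi.single (.x m η ν) 1) 0
    | .y η n => if n ≤ N η then homRat 0 (Pi.single η 1)
        else homRat (Pi.single (xGen (M η) η (n - 1)) 1) 0
  refine linearIndependent_of_triangular _ (fun g => ρ g) (fun g => φ g) ?_ ?_
  · rintro ⟨⟨m, η, ν⟩ | ⟨η, n⟩, hg⟩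
    · simp [φ, homRat_genMk, genVal]
    · by_cases hn : n ≤ N η
      · simp only [φ, if_pos hn, homRat_genMk]
        exact genVal_zero_y_ne_zero (by simp) n
      · obtain ⟨n, rfl⟩ := Nat.exists_eq_add_one_of_ne_zero (by omega : n ≠ 0)
        simp only [φ, if_neg hn, homRat_genMk, genVal_y_succ, Nat.add_sub_cancel]
        rw [genVal_y_eq_zero rfl, Finset.sum_eq_single (M η)]
        · simpa using n.factorial_ne_zero
        · intro m _ hm
          exact Pi.single_eq_of_ne (fun h => hm (xGen_eq_iff.1 h).1) _
        · simp
        · intro i hi m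
          exact Pi.single_eq_of_ne (fun h => hi.ne (xGen_eq_iff.1 h).2.1) _
  · rintro ⟨⟨m, η, ν⟩ | ⟨η, n⟩, hg⟩ ⟨⟨m', η', ν'⟩ | ⟨η', n'⟩, hg'⟩ hne hle
    · have hne : Gen.x m' η' ν' ≠ .x m η ν := fun h => hne (Subtype.ext h)
      simp only [φ, homRat_genMk, genVal]
      exact Pi.single_eq_of_ne hne _
    · simp [ρ] at hle
    · have hη : ∀ l, η l ∈ U := hg.1
      by_cases hn : n ≤ N η
      · simp [φ, if_pos hn, homRat_genMk, genVal]
      · simp only [φ, if_neg hn, homRat_genMk, genVal]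
        exact Pi.single_eq_of_ne
          (fun h => hg'.2.1 ⟨η, hη, n - 1, by omega, h⟩) _
    · have hη : ∀ l, η l ∈ U := hg.1
      have hη' : ∀ l, η' l ∈ U := hg'.1
      have hle : f η' < f η ∨ f η' = f η ∧ n' ≤ n := by
        simpa [ρ, Prod.Lex.toLex_le_toLex] using hle
      have hlt : f η' < f η ∨ η' = η ∧ n' < n := by
        refine hle.imp_right fun h => ?_
        obtain rfl := hf hη' hη h.1
        exact ⟨rfl, h.2.lt_of_ne fun h => hne (by subst h; rfl)⟩
      by_cases hn : n ≤ N η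
      · simp only [φ, if_pos hn, homRat_genMk]
        refine genVal_y_eq_zero (Pi.single_eq_of_ne ?_ _) fun _ _ _ => rfl
        rintro rfl
        rcases hlt with h | h
        · exact h.false
        · exact (h.2.trans_le hn).not_ge (hg'.2.2 _ _ rfl)
      · simp only [φ, if_neg hn, homRat_genMk]
        refine genVal_y_eq_zero rfl fun i hi m => Pi.single_eq_of_ne (fun h => ?_) _
        obtain rfl := (xGen_eq_iff.1 h).2.1
        rcases hlt with hlt | hlt
        · exact hsep η hη η' hη' hlt (n - 1) (by omega) m h
        · omega

theorem y_mem_basisGens {k : ℕ} {U : Set (ℕ → Bool)}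
    {M : (Fin (k + 1) → ℕ → Bool) → Fin (k + 1)} {N : (Fin (k + 1) → ℕ → Bool) → ℕ}
    {η : Fin (k + 1) → ℕ → Bool} (hη : ∀ l, η l ∈ U) {n : ℕ} (hn : N η ≤ n) :
    Gen.y η n ∈ basisGens U M N := by
  refine ⟨hη, ?_, ?_⟩
  · rintro ⟨η', -, n', -, h⟩
    exact nomatch h
  · rintro _ _ ⟨⟩
    exact hn

theorem xGen_mem_span_basisGens {k : ℕ} {U : Set (ℕ → Bool)}
    {f : (Fin (k + 1) → ℕ → Bool) → Ordinal.{0}}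
    {M : (Fin (k + 1) → ℕ → Bool) → Fin (k + 1)} {N : (Fin (k + 1) → ℕ → Bool) → ℕ}
    (hf : Set.InjOn f {η | ∀ l, η l ∈ U}) (hsep : Separates U f M N)
    {η : Fin (k + 1) → ℕ → Bool} (hη : ∀ l, η l ∈ U) {n : ℕ} (hn : N η ≤ n) :
    genMk k (xGen (M η) η n) ∈ Submodule.span ℤ (genMk k '' basisGens U M N) := by
  induction hα : f η using WellFoundedLT.induction generalizing η n with
  | ind α ih =>
  subst hα
  have hrel := factorial_smul_genMk_y η n
  rw [← Finset.sum_erase_add _ _ (Finset.mem_univ (M η)), ← add_assoc] at hrel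
  rw [← sub_eq_of_eq_add' hrel]
  refine sub_mem (Submodule.smul_mem _ _ (Submodule.subset_span
    ⟨_, y_mem_basisGens hη (hn.trans n.le_succ), rfl⟩)) (add_mem (Submodule.subset_span
    ⟨_, y_mem_basisGens hη hn, rfl⟩) (sum_mem fun m hm => ?_))
  by_cases hred : xGen m η n ∈ redundantGens U M N
  · obtain ⟨η', hη', n', hn', h⟩ := hred
    obtain rfl := (xGen_eq_iff.1 h).2.1
    rw [h]
    refine ih (f η') (lt_of_not_ge fun hle => ?_) hη' hn' rfl
    rcases hle.lt_or_eq with hlt | heq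
    · exact hsep η' hη' η hη hlt n hn' m h
    · obtain rfl := hf hη hη' heq
      exact Finset.ne_of_mem_erase hm (xGen_eq_iff.1 h).1
  · exact Submodule.subset_span
      ⟨_, ⟨xGen_mem_genIn hη m n, hred, fun _ _ h => nomatch h⟩, rfl⟩

theorem GU_eq_span_basisGens {k : ℕ} {U : Set (ℕ → Bool)}
    {f : (Fin (k + 1) → ℕ → Bool) → Ordinal.{0}}
    {M : (Fin (k + 1) → ℕ → Bool) → Fin (k + 1)} {N : (Fin (k + 1) → ℕ → Bool) → ℕ}
    (hf : Set.InjOn f {η | ∀ l, η l ∈ U}) (hsep : Separates U f M N) :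
    GU k U = (Submodule.span ℤ (genMk k '' basisGens U M N)).toAddSubgroup := by
  have hx : ∀ m η ν, Gen.x m η ν ∈ genIn k U →
      genMk k (.x m η ν) ∈ Submodule.span ℤ (genMk k '' basisGens U M N) := by
    intro m η ν hg
    by_cases hred : Gen.x m η ν ∈ redundantGens U M N
    · obtain ⟨η', hη', n, hn, h⟩ := hred
      rw [h]
      exact xGen_mem_span_basisGens hf hsep hη' hn
    · exact Submodule.subset_span ⟨_, ⟨hg, hred, fun _ _ h => nomatch h⟩, rfl⟩
  apply le_antisymm
  · rw [GU, AddSubgroup.closure_le]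
    rintro _ ⟨⟨m, η, ν⟩ | ⟨η, n⟩, hg, rfl⟩
    · exact hx m η ν hg
    · have hη : ∀ l, η l ∈ U := hg
      clear hg
      change genMk k (.y η n) ∈ Submodule.span ℤ (genMk k '' basisGens U M N)
      rcases le_total (N η) n with hn | hn
      · exact Submodule.subset_span ⟨_, y_mem_basisGens hη hn, rfl⟩
      · induction hn using Nat.decreasingInduction with
        | self => exact Submodule.subset_span ⟨_, y_mem_basisGens hη le_rfl, rfl⟩
        | of_succ n hn ih =>
          rw [← sub_eq_of_eq_add (factorial_smul_genMk_y η n)]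
          exact sub_mem (Submodule.smul_mem _ _ ih)
            (sum_mem fun m _ => hx _ _ _ (xGen_mem_genIn hη m n))
  · change Submodule.span ℤ _ ≤ (GU k U).toIntSubmodule
    rw [Submodule.span_le]
    exact fun g ⟨b, hb, h⟩ => AddSubgroup.subset_closure ⟨b, hb.1, h⟩

/-- If `U ⊆ 2^ω` has cardinality at most `ℵ_k`, then the subgroup `G_U` of `G_k` is a
free abelian group. -/
theorem GU_free_of_small (k : ℕ) (U : Set (ℕ → Bool))
    (hU : Cardinal.mk U ≤ Cardinal.aleph k) :
    Module.Free ℤ (GU k U) := by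
  obtain ⟨f, M, N, hf, hsep⟩ := exists_separates hU
  have hspan := Module.Free.of_basis (Module.Basis.span (linearIndependent_basisGens hf hsep))
  rw [← Set.image_eq_range] at hspan
  rw [GU_eq_span_basisGens hf hsep]
  exact hspan
end
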